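/- Let R be a nonzero ring, Γ = (V,E) a finite simple graph, and {G_v}_{v∈V} groups such that each G_v admits an injective homomorphism into GL_{m_v}(R) for some m_v ≥ 1. Then there exist a natural number N, injective group homomorphisms λ_v : G_v → GL_N(R[X]) (where R[X] is the univariate polynomial ring over R), and subsets J_v ⊆ {1,…,N} such that: (a) J_u ∩ J_v = ∅ whenever {u,v} ∈ E; (b) |J_u ∩ J_v| ≥ 3 whenever u ≠ v and {u,v} ∉ E; (c) J_u ∩ J_v ∩ J_w = ∅ for any three pairwise distinct u,v,w; and for every v ∈ V and every g ∈ G_v with g ≠ 1: λ_v(g)_{i,j} ≠ 0 whenever i,j ∈ J_v with i ≠ j, and λ_v(g)_{i,j} = δ_{i,j} whenever (i,j) ∉ J_v × J_v. -/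

import Mathlib

/-- If `W * U = 1`, then `A ↦ 1 + U * (A - 1) * W` is multiplicative. -/
def Matrix.inflate {S m n : Type*} [Ring S] [Fintype m] [DecidableEq m] [Fintype n]
    [DecidableEq n] (U : Matrix n m S) (W : Matrix m n S) (h : W * U = 1) :
    Matrix m m S →* Matrix n n S where
  toFun A := 1 + U * (A - 1) * W
  map_one' := by simp
  map_mul' A B := by
    have key : U * (A - 1) * W * (U * (B - 1) * W) = U * ((A - 1) * (B - 1)) * W := by
      calc U * (A - 1) * W * (U * (B - 1) * W)
          = U * (A - 1) * (W * U) * (B - 1) * W := by simp only [Matrix.mul_assoc]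
        _ = U * ((A - 1) * (B - 1)) * W := by rw [h, Matrix.mul_one, Matrix.mul_assoc U]
    have e : A * B - 1 = (A - 1) + (B - 1) + (A - 1) * (B - 1) := by noncomm_ring
    rw [e, add_mul, one_mul, mul_add, mul_one, key]
    simp only [Matrix.mul_add, Matrix.add_mul]
    abel

open Polynomial in
theorem Polynomial.coeff_add_X_pow_mul_C_mul_add_X_pow {R : Type*} [Ring R] (c d b : R)
    (s : Bool) {p q D : ℕ} (hp : 0 < p) (hq : 0 < q) (hD : p + q ≤ D) :
    ((C c + X ^ p) * C b * (C d - (bif s then X ^ q else -X ^ q))).coeff D =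
      if D = p + q then (bif s then -b else b) else 0 := by
  have h1 : (C c * C b * C d).coeff D = 0 := by
    rw [← C_mul, ← C_mul, coeff_C_of_ne_zero (by omega)]
  have h2 : (X ^ p * C b * C d).coeff D = 0 := by
    rw [mul_assoc, ← C_mul, X_pow_mul, coeff_C_mul, coeff_X_pow, if_neg (by omega), mul_zero]
  have h3 : (C c * C b * X ^ q).coeff D = 0 := by
    rw [← C_mul, coeff_C_mul, coeff_X_pow, if_neg (by omega), mul_zero]
  have h4 : (X ^ p * C b * X ^ q).coeff D = if D = p + q then b else 0 := by
    rw [X_pow_mul, mul_assoc, ← pow_add, coeff_C_mul, coeff_X_pow, mul_ite, mul_one, mul_zero]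
  cases s <;>
    simp only [cond_true, cond_false, add_mul, mul_sub, mul_neg, coeff_add, coeff_sub, coeff_neg,
      h1, h2, h3, h4] <;> split_ifs <;> simp

open Polynomial in
/-- A representation of `Matrix m m R` over `R[X]` that is the identity off `J × Bool` and all of
whose entries inside, for matrices other than `1`, are nonzero off the diagonal. -/
theorem Matrix.exists_monoidHom_polynomial_supported {R T m : Type*} [Ring R] [Fintype T]
    [DecidableEq T] [Fintype m] [DecidableEq m] (J : Set T) (e : m ↪ T) (he : ∀ k, e k ∈ J) :
    ∃ φ : Matrix m m R →* Matrix (T × Bool) (T × Bool) R[X], ∀ A,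
      (A ≠ 1 → ∀ i j, i.1 ∈ J → j.1 ∈ J → i ≠ j → φ A i j ≠ 0) ∧
      ∀ i j, ¬(i.1 ∈ J ∧ j.1 ∈ J) → φ A i j = (1 : Matrix (T × Bool) (T × Bool) R[X]) i j := by
  classical
  obtain ⟨α, β, hβ, hinj⟩ : ∃ α β : T → ℕ, (∀ t, 0 < β t) ∧
      ∀ t t' u u', α t + β t' = α u + β u' → t = u ∧ t' = u' := by
    let τ := Fintype.equivFin T
    refine ⟨fun t => τ t, fun t => Fintype.card T * τ t + 1, fun t => Nat.succ_pos _, ?_⟩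
    intro t t' u u' h
    have : finProdFinEquiv (τ t', τ t) = finProdFinEquiv (τ u', τ u) := by
      ext
      simp only [finProdFinEquiv_apply_val]
      dsimp only at h
      omega
    simpa [and_comm] using this
  let U : Matrix (T × Bool) m R[X] := Matrix.of fun i k =>
    C (if i = (e k, true) then 1 else 0) + if i.1 ∈ J then X ^ (α i.1 + β (e k)) else 0
  let W : Matrix m (T × Bool) R[X] := Matrix.of fun l j =>
    C (if j = (e l, true) then 1 else 0) -
      if j.1 ∈ J then (bif j.2 then X ^ (α (e l) + β j.1) else -X ^ (α (e l) + β j.1)) else 0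
  have hWU : W * U = 1 := by
    ext1 l k
    have hU : ∀ i, (C (if i = (e l, true) then (1 : R) else 0)) * U i k =
        if i = (e l, true) then U i k else 0 := by
      intro i; split_ifs <;> simp
    simp only [Matrix.mul_apply, W, Matrix.of_apply, sub_mul, Finset.sum_sub_distrib, hU, Finset.sum_ite_eq',
      Finset.mem_univ, if_true]
    rw [Fintype.sum_prod_type]
    simp only [Fintype.sum_bool, U, Matrix.of_apply, cond_true, cond_false, Prod.mk.injEq, and_true, and_false,
      if_true, he, reduceCtorEq, if_false, map_zero, zero_add, e.injective.eq_iff]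
    have hsum : ∀ t : T, ((if t ∈ J then (X : R[X]) ^ (α (e l) + β t) else 0) *
          (C (if t = e k then 1 else 0) + if t ∈ J then X ^ (α t + β (e k)) else 0) +
        (if t ∈ J then -X ^ (α (e l) + β t) else 0) *
          (if t ∈ J then X ^ (α t + β (e k)) else 0)) =
        if t = e k then X ^ (α (e l) + β (e k)) else 0 := by
      intro t
      by_cases ht : t = e k
      · subst ht; simp [he, mul_add]
      · by_cases hJ : t ∈ J <;> simp [ht, hJ]
    simp only [hsum, Finset.sum_ite_eq', Finset.mem_univ, if_true, add_sub_cancel_right]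
    simp only [Matrix.one_apply]
    split_ifs <;> simp
  refine ⟨(Matrix.inflate U W hWU).comp (C : R →+* R[X]).mapMatrix.toMonoidHom, fun A => ?_⟩
  have hφ : ∀ i j, ((Matrix.inflate U W hWU).comp (C : R →+* R[X]).mapMatrix.toMonoidHom) A i j =
      (1 : Matrix (T × Bool) (T × Bool) R[X]) i j +
        ∑ l, ∑ k, U i k * C ((A - 1) k l) * W l j := by
    intro i j
    have : (C : R →+* R[X]).mapMatrix A - 1 = (C : R →+* R[X]).mapMatrix (A - 1) := by
      rw [map_sub, map_one]
    change (1 + U * ((C : R →+* R[X]).mapMatrix A - 1) * W : Matrix _ _ _) i j = _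
    rw [this]
    simp [Matrix.mul_apply, Finset.sum_mul]
  refine ⟨fun hA i j hi hj hij h0 => ?_, fun i j hij => ?_⟩
  · obtain ⟨q₀, hq₀, hmax⟩ := Set.exists_max_image {q : m × m | (A - 1) q.1 q.2 ≠ 0}
      (fun q => α (e q.2) + β (e q.1)) (Set.toFinite _) (by
        by_contra hne
        rw [Set.not_nonempty_iff_eq_empty, Set.eq_empty_iff_forall_notMem] at hne
        refine hA (sub_eq_zero.mp ?_)
        ext k l
        by_contra hkl
        exact hne (k, l) hkl)
    obtain ⟨k₀, l₀⟩ := q₀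
    rw [hφ, Matrix.one_apply_ne hij, zero_add] at h0
    have hc := congrArg (fun P : R[X] => P.coeff (α i.1 + β (e k₀) + (α (e l₀) + β j.1))) h0
    simp only [finsetSum_coeff, coeff_zero] at hc
    have hterm : ∀ l k, (U i k * C ((A - 1) k l) * W l j).coeff
        (α i.1 + β (e k₀) + (α (e l₀) + β j.1)) =
        if l = l₀ then if k = k₀ then
          (bif j.2 then -(A - 1) k₀ l₀ else (A - 1) k₀ l₀) else 0 else 0 := by
      intro l k
      by_cases hz : (A - 1) k l = 0
      · rw [hz, map_zero, mul_zero, zero_mul, coeff_zero]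
        split_ifs with h1 h2
        · subst h1 h2; exact absurd hz hq₀
        · rfl
        · rfl
      · have hle := hmax (k, l) hz
        simp only at hle
        simp only [U, W, Matrix.of_apply, if_pos hi, if_pos hj]
        rw [coeff_add_X_pow_mul_C_mul_add_X_pow _ _ _ _ (by have := hβ (e k); omega)
          (by have := hβ j.1; omega) (by omega)]
        by_cases hlk : l = l₀ ∧ k = k₀
        · obtain ⟨rfl, rfl⟩ := hlk
          simp
        · rw [if_neg, ← ite_and, if_neg hlk]
          intro h
          have := hinj (e l₀) (e k₀) (e l) (e k) (by omega)
          exact hlk ⟨(e.injective this.1).symm, (e.injective this.2).symm⟩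
    simp only [hterm, Finset.sum_ite_eq', Finset.sum_ite_irrel, Finset.sum_const_zero,
      Finset.mem_univ, if_true] at hc
    refine hq₀ ?_
    cases hs : j.2 <;> rw [hs] at hc
    · exact hc
    · exact neg_eq_zero.mp hc
  · rw [hφ, add_eq_left]
    refine Finset.sum_eq_zero fun l _ => Finset.sum_eq_zero fun k _ => ?_
    rcases not_and_or.mp hij with h | h
    · have : U i k = 0 := by
        have hne : i ≠ (e k, true) := by rintro rfl; exact h (he k)
        simp [U, h, hne]
      rw [this, zero_mul, zero_mul]
    · have : W l j = 0 := by
        have hne : j ≠ (e l, true) := by rintro rfl; exact h (he l)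
        simp [W, h, hne]
      rw [this, mul_zero]

/-- **Existence of faithful representations with a well-placed collection of supports.**
Given a finite simple graph `Γ` and vertex groups `G_v`, each linear over a nonzero ring
`R`, there are `N`, faithful representations `λ_v : G_v → GL_N(R[X])` and subsets
`J_v ⊆ {1, …, N}` forming a well-placed collection of supports: disjointness along edges,
intersections of size at least 3 along non-edges, empty triple intersections; and for every
nontrivial `g ∈ G_v`, all entries of `λ_v g` inside `J_v × J_v` off the diagonal are
nonzero, while all entries outside `J_v × J_v` agree with the identity matrix. -/
theorem exists_representations_with_wellPlaced_supports
    (R : Type) [Ring R] [Nontrivial R]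
    {V : Type} [Fintype V] (Γ : SimpleGraph V)
    (G : V → Type) [∀ v, Group (G v)]
    (hlin : ∀ v, ∃ (m : ℕ) (_ : 1 ≤ m) (f : G v →* (Matrix (Fin m) (Fin m) R)ˣ),
      Function.Injective f) :
    ∃ (N : ℕ) (lam : ∀ v, G v →* (Matrix (Fin N) (Fin N) (Polynomial R))ˣ)
      (J : V → Set (Fin N)),
      (∀ v, Function.Injective (lam v)) ∧
      (∀ u v : V, Γ.Adj u v → Disjoint (J u) (J v)) ∧
      (∀ u v : V, u ≠ v → ¬Γ.Adj u v → 3 ≤ (J u ∩ J v).ncard) ∧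
      (∀ u v w : V, u ≠ v → v ≠ w → u ≠ w → J u ∩ J v ∩ J w = ∅) ∧
      (∀ (v : V) (g : G v), g ≠ 1 →
        (∀ i j : Fin N, i ∈ J v → j ∈ J v → i ≠ j → (lam v g).val i j ≠ 0) ∧
        (∀ i j : Fin N, ¬(i ∈ J v ∧ j ∈ J v) →
          (lam v g).val i j = if i = j then 1 else 0)) := by
  classical
  choose m hm f hf using hlin
  let T := (Σ v, Fin (m v)) ⊕ (Sym2 V × Bool)
  let K : V → Set T := fun v =>
    {t | Sum.elim (fun p => p.1 = v) (fun p => v ∈ p.1 ∧ p.1 ∉ Γ.edgeSet) t}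
  let e : ∀ v, Fin (m v) ↪ T := fun v =>
    ⟨fun k => Sum.inl ⟨v, k⟩, fun a b h => by simpa using Sum.inl_injective h⟩
  have he : ∀ v k, e v k ∈ K v := fun v k => rfl
  choose φ hφ using fun v => Matrix.exists_monoidHom_polynomial_supported (R := R) (K v) (e v) (he v)
  let ε := Fintype.equivFin (T × Bool)
  let ρ := Matrix.reindexRingEquiv (Polynomial R) ε
  let lam : ∀ v, G v →* (Matrix (Fin _) (Fin _) (Polynomial R))ˣ := fun v =>
    (Units.map (ρ.toMulEquiv.toMonoidHom.comp (φ v))).comp (f v)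
  have hlam : ∀ v g i j, (lam v g).val i j = φ v (f v g).val (ε.symm i) (ε.symm j) :=
    fun v g i j => rfl
  let J : V → Set (Fin (Fintype.card (T × Bool))) := fun v => {i | (ε.symm i).1 ∈ K v}
  have hentries : ∀ (v : V) (g : G v), g ≠ 1 → ∀ i j, i ∈ J v → j ∈ J v → i ≠ j →
      (lam v g).val i j ≠ 0 := by
    intro v g hg i j hi hj hij
    rw [hlam]
    refine (hφ v _).1 (fun h => hg (hf v ?_)) _ _ hi hj (ε.symm.injective.ne hij)
    rw [map_one]
    exact Units.ext h
  refine ⟨_, lam, J, fun v => ?_, fun u v huv => ?_, fun u v huv hadj => ?_,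
    fun u v w huv hvw huw => ?_, fun v g hg => ⟨hentries v g hg, fun i j hij => ?_⟩⟩
  · rw [injective_iff_map_eq_one]
    intro g hg
    by_contra hne
    let t : T := e v ⟨0, hm v⟩
    have hne' : ε (t, true) ≠ ε (t, false) := ε.injective.ne (by simp)
    refine hentries v g hne (ε (t, true)) (ε (t, false)) ?_ ?_ hne' ?_
    · simp [J, t, he]
    · simp [J, t, he]
    · rw [hg, Units.val_one, Matrix.one_apply_ne hne']
  · rw [Set.disjoint_left]
    intro i hu hv
    change (ε.symm i).1 ∈ K u at hu
    change (ε.symm i).1 ∈ K v at hv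
    rcases h : (ε.symm i).1 with p | p <;> rw [h] at hu hv
    · exact huv.ne ((show p.1 = u from hu).symm.trans hv)
    · have hp : p.1 = s(u, v) := (Sym2.mem_and_mem_iff huv.ne).mp ⟨hu.1, hv.1⟩
      exact hu.2 (hp ▸ huv)
  · let ψ : Bool × Bool → Fin (Fintype.card (T × Bool)) := fun b =>
      ε (Sum.inr (s(u, v), b.1), b.2)
    have hψ : Function.Injective ψ := by
      intro b c h
      have h' := Prod.ext_iff.mp (ε.injective h)
      exact Prod.ext (Prod.ext_iff.mp (Sum.inr_injective h'.1)).2 h'.2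
    have hsub : Set.range ψ ⊆ J u ∩ J v := by
      rintro _ ⟨b, rfl⟩
      simp [J, K, ψ, hadj]
    have := Set.ncard_le_ncard hsub (Set.toFinite _)
    rw [← Set.image_univ, Set.ncard_image_of_injective _ hψ, Set.ncard_univ] at this
    simp at this
    omega
  · rw [Set.eq_empty_iff_forall_notMem]
    rintro i ⟨⟨hu, hv⟩, hw⟩
    change (ε.symm i).1 ∈ K u at hu
    change (ε.symm i).1 ∈ K v at hv
    change (ε.symm i).1 ∈ K w at hw
    rcases h : (ε.symm i).1 with p | p <;> rw [h] at hu hv hw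
    · exact huv ((show p.1 = u from hu).symm.trans hv)
    · have hp : p.1 = s(u, v) := (Sym2.mem_and_mem_iff huv).mp ⟨hu.1, hv.1⟩
      have hw' : w ∈ s(u, v) := hp ▸ hw.1
      rcases Sym2.mem_iff.mp hw' with h | h
      · exact huw h.symm
      · exact hvw h.symm
  · rw [hlam, (hφ v _).2 _ _ hij, Matrix.one_apply]
    simp
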